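/- arXiv:1809.08594 — 2 statements merged into one kernel-verified Lean document; each statement's English description precedes it below -/
import Mathlib

section
/- Let L₇ be the real symmetric 7×7 matrix with rows (6,1,1,−1,1,−1,1), (1,6,1,1,−1,1,1), (1,1,6,1,1,−1,−1), (−1,1,1,6,1,1,−1), (1,−1,1,1,6,1,1), (−1,1,−1,1,1,6,1), (1,1,−1,−1,1,1,6). Then the characteristic polynomial of L₇ factors as (x − 7)(x² − 11x + 20)(x² − 12x + 31)². Equivalently, the eigenvalues of L₇ are (11+√41)/2, 6+√5 (with multiplicity 2), 7, 6−√5 (with multiplicity 2), and (11−√41)/2. -/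
open Polynomial

/-- Columns adapted to the primary decomposition of L₇. -/
noncomputable def basisP : Matrix (Fin 7) (Fin 7) ℝ :=
  !![0, 0, 2, -1, -5, -1, -7;
    -1, 1, 5, 0, 0, 0, 0;
    0, 0, 2, 1, 5, 0, 0;
    0, 0, 2, 0, 2, 1, 7;
    1, 1, 5, 0, 0, 0, 0;
    0, 0, 2, 0, 0, 0, 2;
    0, 0, 2, 0, -2, 0, -2]

/-- The inverse of `basisP`. -/
noncomputable def basisQ : Matrix (Fin 7) (Fin 7) ℝ :=
  !![0, -1/2, 0, 0, 1/2, 0, 0;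
    -1/2, 1/2, -1/2, -1/2, 1/2, -1/2, -1/2;
    1/10, 0, 1/10, 1/10, 0, 1/10, 1/10;
    -6/5, 0, -1/5, -6/5, 0, 13/10, 13/10;
    1/5, 0, 1/5, 1/5, 0, -3/10, -3/10;
    1/10, 0, 1/10, 11/10, 0, -12/5, 11/10;
    -1/10, 0, -1/10, -1/10, 0, 2/5, -1/10]

/-- Block form of L₇: companion blocks of the factors. -/
noncomputable def blockB : Matrix (Fin 7) (Fin 7) ℝ :=
  !![7, 0, 0, 0, 0, 0, 0;
    0, 0, -20, 0, 0, 0, 0;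
    0, 1, 11, 0, 0, 0, 0;
    0, 0, 0, 0, -31, 0, 0;
    0, 0, 0, 1, 12, 0, 0;
    0, 0, 0, 0, 0, 0, -31;
    0, 0, 0, 0, 0, 1, 12]

theorem basisQ_mul_basisP : basisQ * basisP = 1 := by
  ext i j
  fin_cases i <;> fin_cases j <;>
    norm_num [basisQ, basisP, Matrix.mul_apply, Fin.sum_univ_succ, Matrix.one_apply]

theorem blockB_charpoly : blockB.charpoly
    = (X - C 7) * (X ^ 2 - C 11 * X + C 20) * (X ^ 2 - C 12 * X + C 31) ^ 2 := by
  have h : blockB.charmatrix =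
      !![X - C 7, 0, 0, 0, 0, 0, 0;
         0, X, C 20, 0, 0, 0, 0;
         0, -1, X - C 11, 0, 0, 0, 0;
         0, 0, 0, X, C 31, 0, 0;
         0, 0, 0, -1, X - C 12, 0, 0;
         0, 0, 0, 0, 0, X, C 31;
         0, 0, 0, 0, 0, -1, X - C 12] := by
    ext i j : 2
    fin_cases i <;> fin_cases j <;> simp [blockB]
  rw [Matrix.charpoly, h]
  simp [Matrix.det_succ_row_zero, Fin.sum_univ_succ, Fin.succAbove]
  ring

set_option maxHeartbeats 1000000 in
/-- The characteristic polynomial of the signed Laplacian `L₇` factors as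
`(x - 7)(x² - 11x + 20)(x² - 12x + 31)²`. -/
theorem charpoly_L7 :
    (!![6, 1, 1, -1, 1, -1, 1;
        1, 6, 1, 1, -1, 1, 1;
        1, 1, 6, 1, 1, -1, -1;
        -1, 1, 1, 6, 1, 1, -1;
        1, -1, 1, 1, 6, 1, 1;
        -1, 1, -1, 1, 1, 6, 1;
        1, 1, -1, -1, 1, 1, 6] : Matrix (Fin 7) (Fin 7) ℝ).charpoly
      = (X - C 7) * (X ^ 2 - C 11 * X + C 20) * (X ^ 2 - C 12 * X + C 31) ^ 2 := by
  have h : (!![6, 1, 1, -1, 1, -1, 1;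
        1, 6, 1, 1, -1, 1, 1;
        1, 1, 6, 1, 1, -1, -1;
        -1, 1, 1, 6, 1, 1, -1;
        1, -1, 1, 1, 6, 1, 1;
        -1, 1, -1, 1, 1, 6, 1;
        1, 1, -1, -1, 1, 1, 6] : Matrix (Fin 7) (Fin 7) ℝ) * basisP
      = basisP * blockB := by
    ext i j
    fin_cases i <;> fin_cases j <;>
      norm_num [basisP, blockB, Matrix.mul_apply, Fin.sum_univ_succ]
  generalize (!![6, 1, 1, -1, 1, -1, 1;
        1, 6, 1, 1, -1, 1, 1;
        1, 1, 6, 1, 1, -1, -1;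
        -1, 1, 1, 6, 1, 1, -1;
        1, -1, 1, 1, 6, 1, 1;
        -1, 1, -1, 1, 1, 6, 1;
        1, 1, -1, -1, 1, 1, 6] : Matrix (Fin 7) (Fin 7) ℝ) = L at h ⊢
  have hL : L = basisP * (blockB * basisQ) := by
    rw [← Matrix.mul_assoc, ← h, Matrix.mul_assoc, mul_eq_one_comm.mp basisQ_mul_basisP,
      Matrix.mul_one]
  rw [hL, Matrix.charpoly_mul_comm, Matrix.mul_assoc, basisQ_mul_basisP, Matrix.mul_one,
    blockB_charpoly]
end

section
/- Let L₇ be the real symmetric 7×7 matrix with rows (6,1,1,−1,1,−1,1), (1,6,1,1,−1,1,1), (1,1,6,1,1,−1,−1), (−1,1,1,6,1,1,−1), (1,−1,1,1,6,1,1), (−1,1,−1,1,1,6,1), (1,1,−1,−1,1,1,6). Then the sum of the 4 largest eigenvalues of L₇ (counted with multiplicity) equals 49/2 + √41/2 + 2√5 (approximately 32.1735). -/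
set_option maxHeartbeats 4000000 in
open Polynomial in
/-- Characteristic polynomial of the block form of `L₇`. -/
lemma charpoly_blockForm :
    (!![5, 10, 0, 0, 0, 0, 0;
        1, 6, 0, 0, 0, 0, 0;
        0, 0, 7, 0, 0, 0, 0;
        0, 0, 0, 6, 5, 0, 0;
        0, 0, 0, 1, 6, 0, 0;
        0, 0, 0, 0, 0, 6, 5;
        0, 0, 0, 0, 0, 1, 6] : Matrix (Fin 7) (Fin 7) ℝ).charpoly
      = ((X - C 5) * (X - C 6) - C 10) * (X - C 7) * ((X - C 6) * (X - C 6) - C 5) ^ 2 := by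
  have h : (!![5, 10, 0, 0, 0, 0, 0;
        1, 6, 0, 0, 0, 0, 0;
        0, 0, 7, 0, 0, 0, 0;
        0, 0, 0, 6, 5, 0, 0;
        0, 0, 0, 1, 6, 0, 0;
        0, 0, 0, 0, 0, 6, 5;
        0, 0, 0, 0, 0, 1, 6] : Matrix (Fin 7) (Fin 7) ℝ).charmatrix
      = !![X - C 5, - C 10, 0, 0, 0, 0, 0;
        - 1, X - C 6, 0, 0, 0, 0, 0;
        0, 0, X - C 7, 0, 0, 0, 0;
        0, 0, 0, X - C 6, - C 5, 0, 0;
        0, 0, 0, - 1, X - C 6, 0, 0;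
        0, 0, 0, 0, 0, X - C 6, - C 5;
        0, 0, 0, 0, 0, - 1, X - C 6] := by
    ext1 i j
    fin_cases i <;> fin_cases j <;>
      simp [Matrix.charmatrix_apply]
  rw [Matrix.charpoly, h]
  generalize (X - C 5 : ℝ[X]) = a
  generalize (X - C 6 : ℝ[X]) = b
  generalize (X - C 7 : ℝ[X]) = c
  generalize (C 10 : ℝ[X]) = d
  generalize (C 5 : ℝ[X]) = e
  simp [Matrix.det_succ_row_zero, Fin.sum_univ_succ, Fin.succAbove]
  ring

set_option maxHeartbeats 4000000 in
/-- Similarity of `L₇` with its block form. -/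
lemma L7_eq_conj :
    (!![6, 1, 1, -1, 1, -1, 1;
        1, 6, 1, 1, -1, 1, 1;
        1, 1, 6, 1, 1, -1, -1;
        -1, 1, 1, 6, 1, 1, -1;
        1, -1, 1, 1, 6, 1, 1;
        -1, 1, -1, 1, 1, 6, 1;
        1, 1, -1, -1, 1, 1, 6] : Matrix (Fin 7) (Fin 7) ℝ).charpoly =
    (!![5, 10, 0, 0, 0, 0, 0;
        1, 6, 0, 0, 0, 0, 0;
        0, 0, 7, 0, 0, 0, 0;
        0, 0, 0, 6, 5, 0, 0;
        0, 0, 0, 1, 6, 0, 0;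
        0, 0, 0, 0, 0, 6, 5;
        0, 0, 0, 0, 0, 1, 6] : Matrix (Fin 7) (Fin 7) ℝ).charpoly := by
  set A : Matrix (Fin 7) (Fin 7) ℝ := !![6, 1, 1, -1, 1, -1, 1;
        1, 6, 1, 1, -1, 1, 1;
        1, 1, 6, 1, 1, -1, -1;
        -1, 1, 1, 6, 1, 1, -1;
        1, -1, 1, 1, 6, 1, 1;
        -1, 1, -1, 1, 1, 6, 1;
        1, 1, -1, -1, 1, 1, 6] with hA
  set B : Matrix (Fin 7) (Fin 7) ℝ := !![5, 10, 0, 0, 0, 0, 0;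
        1, 6, 0, 0, 0, 0, 0;
        0, 0, 7, 0, 0, 0, 0;
        0, 0, 0, 6, 5, 0, 0;
        0, 0, 0, 1, 6, 0, 0;
        0, 0, 0, 0, 0, 6, 5;
        0, 0, 0, 0, 0, 1, 6] with hB
  let P : Matrix (Fin 7) (Fin 7) ℝ := !![0, 2, 0, -1, 1, -1, -1;
  1, 0, -1, 0, 0, 0, 0;
  0, 2, 0, 1, -1, 0, 0;
  0, 2, 0, 0, 2, 1, 1;
  1, 0, 1, 0, 0, 0, 0;
  0, 2, 0, 0, 0, 0, 2;
  0, 2, 0, 0, -2, 0, -2]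
  let Q : Matrix (Fin 7) (Fin 7) ℝ := !![0, 1/2, 0, 0, 1/2, 0, 0;
  1/10, 0, 1/10, 1/10, 0, 1/10, 1/10;
  0, -1/2, 0, 0, 1/2, 0, 0;
  0, 0, 1, 0, 0, -1/2, -1/2;
  1/5, 0, 1/5, 1/5, 0, -3/10, -3/10;
  -1/2, 0, -1/2, 1/2, 0, 0, 1/2;
  -1/10, 0, -1/10, -1/10, 0, 2/5, -1/10]
  have hQP : Q * P = 1 := by
    ext i j
    fin_cases i <;> fin_cases j <;>
      norm_num [Q, P, Matrix.mul_apply, Fin.sum_univ_succ, Matrix.one_apply]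
  have hPQ : P * Q = 1 := mul_eq_one_comm.mp hQP
  have hAP : A * P = P * B := by
    ext i j
    fin_cases i <;> fin_cases j <;>
      norm_num [hA, hB, P, Matrix.mul_apply, Fin.sum_univ_succ]
  have : A = P * (B * Q) := by
    rw [← mul_assoc, ← hAP, mul_assoc, hPQ, mul_one]
  rw [this, Matrix.charpoly_mul_comm, mul_assoc, hQP, mul_one]

open Polynomial in
/-- The factored polynomial in terms of its sorted list of roots. -/
lemma blockPoly_roots :
    (((X - C 5) * (X - C 6) - C 10) * (X - C 7) * ((X - C 6) * (X - C 6) - C 5) ^ 2 : ℝ[X]).roots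
      = (([(11 + Real.sqrt 41) / 2, 6 + Real.sqrt 5, 6 + Real.sqrt 5, 7, 6 - Real.sqrt 5,
          6 - Real.sqrt 5, (11 - Real.sqrt 41) / 2] : List ℝ) : Multiset ℝ) := by
  have h41 : Real.sqrt 41 * Real.sqrt 41 = 41 := Real.mul_self_sqrt (by norm_num)
  have h5 : Real.sqrt 5 * Real.sqrt 5 = 5 := Real.mul_self_sqrt (by norm_num)
  have e1 : ((X - C 5) * (X - C 6) - C 10 : ℝ[X])
      = (X - C ((11 + Real.sqrt 41) / 2)) * (X - C ((11 - Real.sqrt 41) / 2)) := by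
    apply Polynomial.funext
    intro x
    simp only [eval_sub, eval_mul, eval_X, eval_C]
    linear_combination h41 / 4
  have e2 : ((X - C 6) * (X - C 6) - C 5 : ℝ[X])
      = (X - C (6 + Real.sqrt 5)) * (X - C (6 - Real.sqrt 5)) := by
    apply Polynomial.funext
    intro x
    simp only [eval_sub, eval_mul, eval_X, eval_C]
    linear_combination h5
  rw [e1, e2]
  refine Eq.trans ?_ (Polynomial.roots_multiset_prod_X_sub_C _)
  congr 1
  simp only [Multiset.map_coe, Multiset.prod_coe, List.map_cons, List.map_nil, List.prod_cons,
    List.prod_nil]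
  ring


/-- The sum of the 4 largest eigenvalues of the signed Laplacian `L₇` (counted
with multiplicity) equals `49/2 + √41/2 + 2√5`: for any permutation arranging
the eigenvalues in (weakly) decreasing order, the first 4 sum to that value. -/
theorem sum_four_largest_eigenvalues_L7_eq
    (hL : (!![6, 1, 1, -1, 1, -1, 1;
              1, 6, 1, 1, -1, 1, 1;
              1, 1, 6, 1, 1, -1, -1;
              -1, 1, 1, 6, 1, 1, -1;
              1, -1, 1, 1, 6, 1, 1;
              -1, 1, -1, 1, 1, 6, 1;
              1, 1, -1, -1, 1, 1, 6] : Matrix (Fin 7) (Fin 7) ℝ).IsHermitian) :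
    ∀ σ : Equiv.Perm (Fin 7), Antitone (fun i => hL.eigenvalues (σ i)) →
      ∑ i ∈ Finset.univ.filter (fun i : Fin 7 => (i : ℕ) < 4), hL.eigenvalues (σ i)
        = 49 / 2 + Real.sqrt 41 / 2 + 2 * Real.sqrt 5 := by
  intro σ hσ
  have hr := hL.roots_charpoly_eq_eigenvalues
  rw [L7_eq_conj, charpoly_blockForm, blockPoly_roots] at hr
  have hperm : (List.ofFn (fun i => hL.eigenvalues (σ i))).Perm
      [(11 + Real.sqrt 41) / 2, 6 + Real.sqrt 5, 6 + Real.sqrt 5, 7, 6 - Real.sqrt 5,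
          6 - Real.sqrt 5, (11 - Real.sqrt 41) / 2] := by
    refine (Equiv.Perm.ofFn_comp_perm σ hL.eigenvalues).trans ?_
    rw [← Multiset.coe_eq_coe, hr, Fin.univ_val_map]
    rfl
  have a1 : 6.4 < Real.sqrt 41 := Real.lt_sqrt_of_sq_lt (by norm_num)
  have b1 : 2.2 < Real.sqrt 5 := Real.lt_sqrt_of_sq_lt (by norm_num)
  have b2 : Real.sqrt 5 < 2.25 := by
    rw [Real.sqrt_lt' (by norm_num)]; norm_num
  have hs : ([(11 + Real.sqrt 41) / 2, 6 + Real.sqrt 5, 6 + Real.sqrt 5, 7, 6 - Real.sqrt 5,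
          6 - Real.sqrt 5, (11 - Real.sqrt 41) / 2] : List ℝ).SortedGE := by
    rw [List.sortedGE_iff_pairwise]
    norm_num at a1 b1 b2
    simp only [List.pairwise_cons, List.mem_cons, List.not_mem_nil, or_false, ge_iff_le,
      forall_eq_or_imp, forall_eq, List.Pairwise.nil, and_true, IsEmpty.forall_iff,
      implies_true]
    refine ⟨⟨?_, ?_, ?_, ?_, ?_, ?_⟩, ⟨?_, ?_, ?_, ?_, ?_⟩, ⟨?_, ?_, ?_, ?_⟩, ⟨?_, ?_, ?_⟩,
      ⟨?_, ?_⟩, ?_⟩ <;> linarith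
  have heq := List.Perm.eq_of_sortedGE hσ.sortedGE_ofFn hs hperm
  simp only [List.ofFn_succ, List.ofFn_zero, List.cons.injEq] at heq
  obtain ⟨h0, h1, h2, h3, -⟩ := heq
  have hf : (Finset.univ.filter (fun i : Fin 7 => (i : ℕ) < 4)) = {0, 1, 2, 3} := by decide
  rw [hf]
  simp at h0 h1 h2 h3
  rw [Finset.sum_insert (by decide), Finset.sum_insert (by decide),
    Finset.sum_insert (by decide), Finset.sum_singleton]
  have h1' : hL.eigenvalues (σ 1) = _ := h1
  have h2' : hL.eigenvalues (σ 2) = _ := h2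
  have h3' : hL.eigenvalues (σ 3) = _ := h3
  rw [h0, h1', h2', h3']
  ring
end
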